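/- Let 𝕋 be a hyperaffine–unary algebraic theory. Then the hyperaffine operations of 𝕋 form a subtheory: every projection π_i is hyperaffine, and if h ∈ T(I) is hyperaffine and k_i ∈ T(J) is hyperaffine for every i ∈ I, then the substitution h(k) ∈ T(J) is hyperaffine. (In particular, in a hyperaffine–unary theory every affine operation is hyperaffine.) -/

import Mathlib

/-- An (infinitary) algebraic theory. -/
structure AlgTheory where
  T : Type → Type
  pr : ∀ {I : Type}, I → T I
  subst : ∀ {I J : Type}, T I → (I → T J) → T J
  subst_pr : ∀ {I : Type} (t : T I), subst t (fun i => pr i) = t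
  pr_subst : ∀ {I J : Type} (i : I) (u : I → T J), subst (pr i) u = u i
  subst_assoc : ∀ {I J K : Type} (t : T I) (u : I → T J) (v : J → T K),
      subst (subst t u) v = subst t (fun i => subst (u i) v)

def AlgTheory.IsAffine (𝕋 : AlgTheory) {I : Type} (t : 𝕋.T I) : Prop :=
  𝕋.subst t (fun _ => 𝕋.pr PUnit.unit) = 𝕋.pr PUnit.unit

def AlgTheory.IsHyperaffine (𝕋 : AlgTheory) {I : Type} (t : 𝕋.T I) : Prop :=
  𝕋.IsAffine t ∧
  𝕋.subst t (fun i => 𝕋.subst t (fun j => 𝕋.pr (i, j))) =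
    𝕋.subst t (fun i => 𝕋.pr (i, i))

/-- `𝕋` is hyperaffine–unary: every operation `t` decomposes uniquely as
`t = h(λ i. m)`, i.e. `t = h(λ i. m(π_i))`, with `h` hyperaffine and `m`
unary. -/
def AlgTheory.HyperaffineUnary (𝕋 : AlgTheory) : Prop :=
  ∀ (I : Type) (t : 𝕋.T I), ∃! p : 𝕋.T I × 𝕋.T PUnit,
    𝕋.IsHyperaffine p.1 ∧
    t = 𝕋.subst p.1 (fun i => 𝕋.subst p.2 (fun _ => 𝕋.pr i))

namespace AlgTheory

variable {𝕋 : AlgTheory} {I J : Type}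

/-- An affine operation sends a constant family to its value. -/
theorem IsAffine.subst_const {t : 𝕋.T I} (ht : 𝕋.IsAffine t) (c : 𝕋.T J) :
    𝕋.subst t (fun _ => c) = c := by
  have h := congrArg (fun s => 𝕋.subst s (fun _ => c)) ht
  simpa only [𝕋.subst_assoc, 𝕋.pr_subst] using h

theorem isAffine_pr (i : I) : 𝕋.IsAffine (𝕋.pr i) :=
  𝕋.pr_subst i _

theorem IsAffine.subst {h : 𝕋.T I} {k : I → 𝕋.T J} (hh : 𝕋.IsAffine h)
    (hk : ∀ i, 𝕋.IsAffine (k i)) : 𝕋.IsAffine (𝕋.subst h k) := by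
  unfold IsAffine
  simp only [𝕋.subst_assoc, (hk _).subst_const, hh.subst_const]

/-- The unary part of an affine operation is trivial, so the operation equals its hyperaffine
part. -/
theorem HyperaffineUnary.isHyperaffine_of_isAffine (hu : 𝕋.HyperaffineUnary) {t : 𝕋.T I}
    (ht : 𝕋.IsAffine t) : 𝕋.IsHyperaffine t := by
  obtain ⟨⟨h, m⟩, ⟨hh, e⟩, -⟩ := hu I t
  dsimp only at hh e
  have hm : m = 𝕋.pr PUnit.unit := by
    have hm_id : 𝕋.subst m (fun _ => 𝕋.pr PUnit.unit) = m := 𝕋.subst_pr m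
    unfold IsAffine at ht
    rw [e] at ht
    simpa only [𝕋.subst_assoc, 𝕋.pr_subst, hm_id, hh.1.subst_const] using ht
  simp only [hm, 𝕋.pr_subst, 𝕋.subst_pr] at e
  exact e ▸ hh

end AlgTheory

/-- In a hyperaffine–unary theory, the hyperaffine operations form a
subtheory: projections are hyperaffine and hyperaffine operations are closed
under substitution.  In particular every affine operation is hyperaffine. -/
theorem hyperaffine_subtheory (𝕋 : AlgTheory) (hu : 𝕋.HyperaffineUnary) :
    (∀ (I : Type) (i : I), 𝕋.IsHyperaffine (𝕋.pr i : 𝕋.T I)) ∧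
    (∀ (I J : Type) (h : 𝕋.T I) (k : I → 𝕋.T J),
      𝕋.IsHyperaffine h → (∀ i, 𝕋.IsHyperaffine (k i)) →
      𝕋.IsHyperaffine (𝕋.subst h k)) ∧
    (∀ (I : Type) (t : 𝕋.T I), 𝕋.IsAffine t → 𝕋.IsHyperaffine t) := by
  have hyp {I : Type} {t : 𝕋.T I} (ht : 𝕋.IsAffine t) : 𝕋.IsHyperaffine t :=
    hu.isHyperaffine_of_isAffine ht
  exact ⟨fun _ i => hyp (AlgTheory.isAffine_pr i),
    fun _ _ _ _ hh hk => hyp (hh.1.subst fun i => (hk i).1), fun _ _ => hyp⟩
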